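/- Let D be a probability distribution over X×Y, h ∈ H a fixed hypothesis, P a prior distribution over H, and δ ∈ (0,1]. With probability at least 1−δ over the draw of an i.i.d. sample S ~ D^m, simultaneously for all distributions Q over H: kl( b̂_S^Q(h) || b_D^Q(h) ) ≤ (1/m_{(h,0)}) [ KL(Q||P) + ln(2√m/δ) ], where b̂_S^Q(h) = E_{h'~Q} L̂_{S_{(h,0)}}(h'), S_{(h,0)} = {(x,y)∈S : ℓ(h(x),y)=0}, and m_{(h,0)} = |S_{(h,0)}|. -/

import Mathlib

/-!
STATEMENT 2 (Conditional PAC-Bayes bound, correct-prediction part).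
With probability at least `1−δ` over `S ∼ D^m`, simultaneously for all
posteriors `Q` over `H`:
`kl(b̂_S^Q(h) ‖ b_D^Q(h)) ≤ (KL(Q‖P) + ln(2√m/δ)) / m_{(h,0)}`.
-/

open MeasureTheory ProbabilityTheory
open scoped ENNReal Classical

/-- Binary KL divergence `kl(q,p) = q ln(q/p) + (1−q) ln((1−q)/(1−p))`. -/
noncomputable def klBin (q p : ℝ) : ℝ :=
  q * Real.log (q / p) + (1 - q) * Real.log ((1 - q) / (1 - p))

/-- Kullback–Leibler divergence `KL(Q‖P)` between measures on `H`
(`∞` when `Q` is not absolutely continuous w.r.t. `P` or the logarithm of the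
density is not integrable). -/
noncomputable def klDivM {H : Type*} [MeasurableSpace H] (Q P : Measure H) : ℝ≥0∞ :=
  if Q ≪ P ∧ Integrable (fun h' => Real.log (Q.rnDeriv P h').toReal) Q then
    ENNReal.ofReal (∫ h', Real.log (Q.rnDeriv P h').toReal ∂Q)
  else ∞

/-- Non-asymptotic Stirling upper bound, from the monotonicity of `Stirling.stirlingSeq`. -/
lemma factorial_le_exp_mul_sqrt {n : ℕ} (hn : n ≠ 0) :
    (n.factorial : ℝ) ≤ Real.exp 1 * √n * (n / Real.exp 1) ^ n := by
  obtain ⟨k, rfl⟩ := Nat.exists_eq_succ_of_ne_zero hn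
  have h1 : Stirling.stirlingSeq (k + 1) ≤ Stirling.stirlingSeq 1 :=
    Stirling.stirlingSeq'_antitone (Nat.zero_le k)
  rw [Stirling.stirlingSeq_one, Stirling.stirlingSeq, div_le_iff₀ (by positivity)] at h1
  refine h1.trans (le_of_eq ?_)
  rw [Real.sqrt_mul (by norm_num)]
  have : √(2 : ℝ) ≠ 0 := by positivity
  field_simp

lemma choose_mul_pow_mul_pow_le {a b : ℕ} (ha : a ≠ 0) (hb : b ≠ 0) :
    ((a + b).choose a : ℝ) * (a / (a + b : ℕ)) ^ a * (b / (a + b : ℕ)) ^ b ≤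
      Real.exp 1 / (2 * Real.pi) * (1 / √a + 1 / √b) := by
  have ha0 : (0 : ℝ) < a := by positivity
  have hb0 : (0 : ℝ) < b := by positivity
  have hs0 : (0 : ℝ) < (a + b : ℕ) := by positivity
  have hn : a + b ≠ 0 := by positivity
  have h1 := factorial_le_exp_mul_sqrt hn
  have h2 := Stirling.le_factorial_stirling a
  have h3 := Stirling.le_factorial_stirling b
  have hc : ((a + b).choose a : ℝ) * (a.factorial * b.factorial) = (a + b).factorial := by
    have := Nat.choose_mul_factorial_mul_factorial (Nat.le_add_right a b)
    rw [Nat.add_sub_cancel_left] at this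
    rw [← mul_assoc]; exact_mod_cast this
  have hlow : (√(2 * Real.pi * a) * (a / Real.exp 1) ^ a) *
      (√(2 * Real.pi * b) * (b / Real.exp 1) ^ b) ≤ a.factorial * b.factorial := by gcongr
  have hsa : 0 < √(a : ℝ) := by positivity
  have hsb : 0 < √(b : ℝ) := by positivity
  have hsub : √((a + b : ℕ) : ℝ) ≤ √(a : ℝ) + √(b : ℝ) := by
    rw [Real.sqrt_le_left (by positivity)]
    push_cast
    nlinarith [Real.sq_sqrt ha0.le, Real.sq_sqrt hb0.le, mul_pos hsa hsb]
  have hpp : √(2 * Real.pi * a) * √(2 * Real.pi * b) = 2 * Real.pi * (√a * √b) := by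
    rw [Real.sqrt_mul (x := 2 * Real.pi) (by positivity),
      Real.sqrt_mul (x := 2 * Real.pi) (by positivity), mul_mul_mul_comm,
      Real.mul_self_sqrt (by positivity)]
  have hmain : ((a + b).choose a : ℝ) * (2 * Real.pi * (√a * √b) * (a ^ a * b ^ b)) ≤
      Real.exp 1 * (√a + √b) * (a + b : ℕ) ^ (a + b) := by
    have h4 : ((a + b).choose a : ℝ) * ((√(2 * Real.pi * a) * (a / Real.exp 1) ^ a) *
      (√(2 * Real.pi * b) * (b / Real.exp 1) ^ b)) ≤
        Real.exp 1 * √(a + b : ℕ) * ((a + b : ℕ) / Real.exp 1) ^ (a + b) :=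
      (mul_le_mul_of_nonneg_left hlow (by positivity)).trans (hc.le.trans h1)
    have h5 : ((a + b).choose a : ℝ) * ((√(2 * Real.pi * a) * (a / Real.exp 1) ^ a) *
      (√(2 * Real.pi * b) * (b / Real.exp 1) ^ b)) =
        ((a + b).choose a : ℝ) * (2 * Real.pi * (√a * √b) * (a ^ a * b ^ b)) /
          Real.exp 1 ^ (a + b) := by
      rw [← hpp, div_pow, div_pow, pow_add]
      field_simp
    rw [h5, div_pow, ← mul_div_assoc, div_le_div_iff_of_pos_right (by positivity)] at h4
    exact h4.trans (by gcongr)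
  have e1 : ((a + b).choose a : ℝ) * (a / (a + b : ℕ)) ^ a * (b / (a + b : ℕ)) ^ b =
      ((a + b).choose a : ℝ) * (2 * Real.pi * (√a * √b) * (a ^ a * b ^ b)) /
        (2 * Real.pi * (√a * √b) * (a + b : ℕ) ^ (a + b)) := by
    rw [div_pow, div_pow, pow_add]
    field_simp
  have e2 : Real.exp 1 / (2 * Real.pi) * (1 / √a + 1 / √b) =
      Real.exp 1 * (√a + √b) * (a + b : ℕ) ^ (a + b) /
        (2 * Real.pi * (√a * √b) * (a + b : ℕ) ^ (a + b)) := by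
    field_simp
    ring
  rw [e1, e2]
  gcongr

lemma sum_one_div_sqrt_le (n : ℕ) :
    ∑ i ∈ Finset.range (n + 1), 1 / √((i + 1 : ℕ) : ℝ) ≤ 2 * √((n + 1 : ℕ) : ℝ) - 1 := by
  induction n with
  | zero => norm_num
  | succ n ih =>
    rw [Finset.sum_range_succ]
    have h1 : 0 < √((n + 1 : ℕ) : ℝ) := by positivity
    have h2 : 0 < √((n + 1 + 1 : ℕ) : ℝ) := by positivity
    have h3 : √((n + 1 : ℕ) : ℝ) ^ 2 = n + 1 := by rw [Real.sq_sqrt (by positivity)]; simp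
    have h4 : √((n + 1 + 1 : ℕ) : ℝ) ^ 2 = n + 1 + 1 := by
      rw [Real.sq_sqrt (by positivity)]; simp
    have : 1 / √((n + 1 + 1 : ℕ) : ℝ) ≤ 2 * √((n + 1 + 1 : ℕ) : ℝ) - 2 * √((n + 1 : ℕ) : ℝ) := by
      rw [div_le_iff₀ h2]
      nlinarith [sq_nonneg (√((n + 1 + 1 : ℕ) : ℝ) - √((n + 1 : ℕ) : ℝ))]
    linarith

lemma nat_sum_choose_mul_pow_sq_le :
    ∀ k < 20, k ≠ 0 →
      (∑ i ∈ Finset.range (k + 1), k.choose i * i ^ i * (k - i) ^ (k - i)) ^ 2 ≤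
        4 * k * (k ^ k) ^ 2 := by
  decide +kernel

/-- Maurer's inequality. -/
lemma sum_choose_mul_pow_div_le {k : ℕ} (hk : k ≠ 0) :
    ∑ i ∈ Finset.range (k + 1), (k.choose i : ℝ) * ((i / k : ℝ) ^ i * ((k - i : ℕ) / k : ℝ) ^ (k - i))
      ≤ 2 * √k := by
  have hk0 : (0 : ℝ) < k := by positivity
  obtain hlt | hge := lt_or_ge k 20
  · have h := nat_sum_choose_mul_pow_sq_le k hlt hk
    have e : ∑ i ∈ Finset.range (k + 1),
        (k.choose i : ℝ) * ((i / k : ℝ) ^ i * ((k - i : ℕ) / k : ℝ) ^ (k - i)) =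
        (∑ i ∈ Finset.range (k + 1), k.choose i * i ^ i * (k - i) ^ (k - i) : ℕ) / (k : ℝ) ^ k := by
      push_cast
      rw [Finset.sum_div]
      refine Finset.sum_congr rfl fun i hi => ?_
      have : (k : ℝ) ^ k = k ^ i * k ^ (k - i) := by
        rw [← pow_add, Nat.add_sub_cancel' (Nat.lt_succ_iff.1 (Finset.mem_range.1 hi))]
      rw [this, div_pow, div_pow]
      field_simp
    rw [e, div_le_iff₀ (by positivity)]
    refine le_of_sq_le_sq ?_ (by positivity)
    rw [mul_pow, mul_pow, Real.sq_sqrt hk0.le]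
    norm_num only
    exact_mod_cast h
  · obtain ⟨n, rfl⟩ : ∃ n, k = n + 2 := ⟨k - 2, by omega⟩
    rw [Finset.sum_range_succ, Finset.sum_range_succ']
    have hmid : ∑ i ∈ Finset.range (n + 1), ((n + 2).choose (i + 1) : ℝ) *
        (((i + 1 : ℕ) / (n + 2 : ℕ) : ℝ) ^ (i + 1) *
          ((n + 2 - (i + 1) : ℕ) / (n + 2 : ℕ) : ℝ) ^ (n + 2 - (i + 1))) ≤
        ∑ i ∈ Finset.range (n + 1), Real.exp 1 / (2 * Real.pi) *
          (1 / √((i + 1 : ℕ) : ℝ) + 1 / √((n + 1 - 1 - i + 1 : ℕ) : ℝ)) := by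
      refine Finset.sum_le_sum fun i hi => ?_
      have hi' := Finset.mem_range.1 hi
      have := @choose_mul_pow_mul_pow_le (i + 1) (n + 1 - 1 - i + 1) (by omega) (by omega)
      rw [show i + 1 + (n + 1 - 1 - i + 1) = n + 2 by omega, mul_assoc] at this
      rwa [show n + 2 - (i + 1) = n + 1 - 1 - i + 1 by omega]
    rw [← Finset.mul_sum, Finset.sum_add_distrib,
      Finset.sum_range_reflect (fun i => 1 / √((i + 1 : ℕ) : ℝ))] at hmid
    have hs := sum_one_div_sqrt_le n
    have hmono : √((n + 1 : ℕ) : ℝ) ≤ √((n + 2 : ℕ) : ℝ) := by gcongr; omega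
    have hc : Real.exp 1 / (2 * Real.pi) ≤ 0.4330 := by
      rw [div_le_iff₀ (by positivity)]
      linarith [Real.exp_one_lt_d9, Real.pi_gt_d2]
    have h20 : 4.4 ≤ √((n + 2 : ℕ) : ℝ) := by
      refine Real.le_sqrt_of_sq_le ?_
      have : (20 : ℝ) ≤ (n + 2 : ℕ) := by exact_mod_cast hge
      linarith
    have hm2 : Real.exp 1 / (2 * Real.pi) *
        (∑ i ∈ Finset.range (n + 1), 1 / √((i + 1 : ℕ) : ℝ) +
          ∑ i ∈ Finset.range (n + 1), 1 / √((i + 1 : ℕ) : ℝ)) ≤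
        0.4330 * (4 * √((n + 2 : ℕ) : ℝ) - 2) :=
      mul_le_mul hc (by linarith) (by positivity) (by norm_num)
    have hz : ((n + 2 : ℕ) : ℝ) / (n + 2 : ℕ) = 1 := div_self hk0.ne'
    simp only [Nat.choose_zero_right, Nat.choose_self, Nat.cast_one, pow_zero, Nat.sub_zero, hz,
      one_pow, Nat.sub_self]
    linarith

/-- The ratio of the maximal likelihood `(N/k)^N (1-N/k)^(k-N)` of `N` successes in `k` trials to
the likelihood under success probability `p`, i.e. `exp (k * kl(N/k, p))` with value `∞` where the
latter likelihood vanishes. -/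
noncomputable def likelihoodRatio (k N : ℕ) (p : ℝ≥0∞) : ℝ≥0∞ :=
  ENNReal.ofReal ((N / k : ℝ) ^ N * ((k - N : ℕ) / k : ℝ) ^ (k - N)) / (p ^ N * (1 - p) ^ (k - N))

lemma sum_choose_mul_likelihoodRatio_le {k m : ℕ} (hkm : k ≤ m) (hm : 0 < m) (p : ℝ≥0∞) :
    ∑ i ∈ Finset.range (k + 1), k.choose i • (p ^ i * (1 - p) ^ (k - i) * likelihoodRatio k i p) ≤
      ENNReal.ofReal (2 * √m) := by
  have hreal : ∑ i ∈ Finset.range (k + 1),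
      (k.choose i : ℝ) * ((i / k : ℝ) ^ i * ((k - i : ℕ) / k : ℝ) ^ (k - i)) ≤ 2 * √m := by
    rcases eq_or_ne k 0 with rfl | hk
    · have : (1 : ℝ) ≤ √m := Real.one_le_sqrt.2 (by exact_mod_cast hm)
      simp
      linarith
    · refine (sum_choose_mul_pow_div_le hk).trans ?_
      gcongr
  refine le_trans ?_ (ENNReal.ofReal_le_ofReal hreal)
  rw [ENNReal.ofReal_sum_of_nonneg (fun i _ => by positivity)]
  refine Finset.sum_le_sum fun i _ => ?_
  rw [nsmul_eq_mul, ENNReal.ofReal_mul (by positivity), ENNReal.ofReal_natCast]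
  gcongr
  exact ENNReal.mul_div_le

lemma pow_mul_exp_le {N k : ℕ} (hk : k ≠ 0) {x : ℝ} (hx : 0 ≤ x) :
    x ^ N * Real.exp (N - k * x) ≤ (N / k : ℝ) ^ N := by
  rcases eq_or_ne N 0 with rfl | hN
  · simp
    positivity
  · have hN0 : (0 : ℝ) < N := by positivity
    have hk0 : (0 : ℝ) < k := by positivity
    have e : Real.exp (N - k * x) = Real.exp (1 - k * x / N) ^ N := by
      rw [← Real.exp_nat_mul]
      congr 1
      field_simp
    rw [e, ← mul_pow]
    refine pow_le_pow_left₀ (by positivity) ?_ N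
    have h1 : k * x / N ≤ Real.exp (k * x / N - 1) := by
      linarith [Real.add_one_le_exp (k * x / N - 1)]
    have h2 : x ≤ N / k * Real.exp (k * x / N - 1) := by
      calc x = N / k * (k * x / N) := by field_simp
        _ ≤ _ := by gcongr
    calc x * Real.exp (1 - k * x / N)
        ≤ N / k * Real.exp (k * x / N - 1) * Real.exp (1 - k * x / N) := by gcongr
      _ = N / k := by rw [mul_assoc, ← Real.exp_add]; simp

/-- The tangent-plane lower bound of `(q, p) ↦ k * kl(q, p)` at the ratios `u = q/p` and
`v = (1-q)/(1-p)`, in exponential form. -/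
lemma ofReal_exp_le_likelihoodRatio {k N : ℕ} (hk : k ≠ 0) (hN : N ≤ k) {p u v : ℝ}
    (hp0 : 0 ≤ p) (hp1 : p ≤ 1) (hu : 0 < u) (hv : 0 < v) :
    ENNReal.ofReal (Real.exp (k * ((N / k) * Real.log u + (1 - N / k) * Real.log v +
      1 - p * u - (1 - p) * v))) ≤ likelihoodRatio k N (ENNReal.ofReal p) := by
  have hk0 : (0 : ℝ) < k := by positivity
  have h1p : 0 ≤ 1 - p := by linarith
  have pow_div_pos (n : ℕ) : 0 < (n / k : ℝ) ^ n := by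
    rcases eq_or_ne n 0 with rfl | hn
    · simp
    · positivity
  have hnum := mul_pos (pow_div_pos N) (pow_div_pos (k - N))
  rw [likelihoodRatio, ENNReal.le_div_iff_mul_le (Or.inr (by simpa using hnum))
    (Or.inr ENNReal.ofReal_ne_top), ← ENNReal.ofReal_one, ← ENNReal.ofReal_sub _ hp0,
    ← ENNReal.ofReal_pow hp0, ← ENNReal.ofReal_pow h1p, ← ENNReal.ofReal_mul (by positivity),
    ← ENNReal.ofReal_mul (by positivity)]
  refine ENNReal.ofReal_le_ofReal ?_
  have hx := pow_mul_exp_le (N := N) hk (mul_nonneg hp0 hu.le)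
  have hy := pow_mul_exp_le (N := k - N) hk (mul_nonneg h1p hv.le)
  refine le_trans (le_of_eq ?_) (mul_le_mul hx hy (by positivity) (by positivity))
  have e : (k : ℝ) * ((N / k) * Real.log u + (1 - N / k) * Real.log v + 1 - p * u - (1 - p) * v) =
      N * Real.log u + (k - N : ℕ) * Real.log v + (N - k * (p * u)) +
        ((k - N : ℕ) - k * ((1 - p) * v)) := by
    push_cast [hN]
    field_simp
    ring
  rw [e, Real.exp_add, Real.exp_add, Real.exp_add, Real.exp_nat_mul, Real.exp_nat_mul,
    Real.exp_log hu, Real.exp_log hv, mul_pow, mul_pow]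
  ring

lemma measurable_likelihoodRatio {α : Type*} [MeasurableSpace α] {k N : α → ℕ} {p : α → ℝ≥0∞}
    (hk : Measurable k) (hN : Measurable N) (hp : Measurable p) :
    Measurable fun a => likelihoodRatio (k a) (N a) (p a) := by
  have h : Measurable fun x : ℕ × ℕ =>
      ENNReal.ofReal ((x.2 / x.1 : ℝ) ^ x.2 * ((x.1 - x.2 : ℕ) / x.1 : ℝ) ^ (x.1 - x.2)) :=
    measurable_of_countable _
  exact (h.comp (hk.prodMk hN)).div
    ((hp.pow hN).mul ((measurable_const.sub hp).pow (hk.sub hN)))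

section ExponentialMoment

variable {Z ι : Type*} [Fintype ι]

lemma measurable_card_filter {α : Type*} [MeasurableSpace α] {p : α → ι → Prop}
    [∀ a, DecidablePred (p a)] (hp : ∀ j, MeasurableSet {a | p a j}) :
    Measurable fun a => (Finset.univ.filter (p a)).card := by
  simp only [Finset.card_filter]
  refine Finset.measurable_sum _ fun j _ => ?_
  convert Measurable.ite (hp j) measurable_const measurable_const

/-- The samples whose points in `A` are indexed by `J` and whose points in `A ∩ B` are indexed
by `K`. -/
def patternSet (A B : Set Z) (J K : Finset ι) : Set (ι → Z) :=
  Set.pi Set.univ fun j => if j ∈ K then A ∩ B else if j ∈ J then A \ B else Aᶜ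

lemma mem_patternSet_filter (A B : Set Z) (S : ι → Z) :
    S ∈ patternSet A B (Finset.univ.filter fun j => S j ∈ A)
      (Finset.univ.filter fun j => S j ∈ A ∧ S j ∈ B) := by
  intro j _
  by_cases h1 : S j ∈ A <;> by_cases h2 : S j ∈ B <;> simp [h1, h2]

variable [MeasurableSpace Z]

lemma measurableSet_patternSet {A B : Set Z} (hA : MeasurableSet A) (hB : MeasurableSet B)
    (J K : Finset ι) : MeasurableSet (patternSet A B J K) := by
  refine MeasurableSet.univ_pi fun j => ?_
  split_ifs
  exacts [hA.inter hB, hA.diff hB, hA.compl]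

lemma measure_pi_patternSet (D : Measure Z) [IsProbabilityMeasure D] {A B : Set Z}
    (hA : MeasurableSet A) (hB : MeasurableSet B) {J K : Finset ι} (hK : K ⊆ J) :
    Measure.pi (fun _ : ι => D) (patternSet A B J K) =
      D A ^ J.card * D Aᶜ ^ (Fintype.card ι - J.card) *
        (D[B | A] ^ K.card * (1 - D[B | A]) ^ (J.card - K.card)) := by
  have h1 : D (A ∩ B) = D A * D[B | A] := by
    rw [mul_comm, cond_mul_eq_inter hA]
  have h2 : D (A \ B) = D A * (1 - D[B | A]) := by
    rw [ENNReal.mul_sub (fun _ _ => measure_ne_top D A), mul_one, ← h1, ← Set.sdiff_self_inter,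
      measure_sdiff Set.inter_subset_left (hA.inter hB).nullMeasurableSet (measure_ne_top _ _)]
  rw [patternSet, Measure.pi_pi]
  have h3 : ∀ j, D (if j ∈ K then A ∩ B else if j ∈ J then A \ B else Aᶜ) =
      (if j ∈ J then D A else D Aᶜ) *
        (if j ∈ J then (if j ∈ K then D[B | A] else 1 - D[B | A]) else 1) := by
    intro j
    by_cases hj : j ∈ K
    · simp [hj, hK hj, h1]
    · by_cases hj' : j ∈ J <;> simp [hj, hj', h2]
  simp_rw [h3]
  rw [Finset.prod_mul_distrib, Finset.prod_ite, Finset.prod_const, Finset.prod_const,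
    ← Finset.prod_filter]
  have hJ : (Finset.univ.filter fun j => j ∈ J) = J := by ext; simp
  have hJc : (Finset.univ.filter fun j => j ∉ J) = Jᶜ := by ext; simp
  have hJK : (J.filter fun j => j ∈ K) = K := by
    ext j; simpa using fun h => hK h
  have hJKc : (J.filter fun j => j ∉ K) = J \ K := by ext; simp
  rw [hJ, hJc, Finset.prod_ite, Finset.prod_const, Finset.prod_const, hJK, hJKc,
    Finset.card_compl, Finset.card_sdiff_of_subset hK]

/-- Exponential moment bound: the empirical frequency of `B` among the sample points in `A`,
compared with the conditional probability of `B` given `A`. -/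
lemma lintegral_likelihoodRatio_le (D : Measure Z) [IsProbabilityMeasure D] {A B : Set Z}
    (hA : MeasurableSet A) (hB : MeasurableSet B) (hι : 0 < Fintype.card ι) :
    ∫⁻ S, likelihoodRatio (Finset.univ.filter fun j : ι => S j ∈ A).card
        (Finset.univ.filter fun j : ι => S j ∈ A ∧ S j ∈ B).card (D[B | A])
        ∂Measure.pi (fun _ : ι => D) ≤ ENNReal.ofReal (2 * √(Fintype.card ι)) := by
  have hpt : ∀ S : ι → Z, likelihoodRatio (Finset.univ.filter fun j : ι => S j ∈ A).card
      (Finset.univ.filter fun j : ι => S j ∈ A ∧ S j ∈ B).card (D[B | A]) ≤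
      ∑ J : Finset ι, ∑ K ∈ J.powerset, (patternSet A B J K).indicator
        (fun _ => likelihoodRatio J.card K.card (D[B | A])) S := by
    intro S
    have hK : (Finset.univ.filter fun j : ι => S j ∈ A ∧ S j ∈ B) ∈
        (Finset.univ.filter fun j : ι => S j ∈ A).powerset := by
      rw [Finset.mem_powerset]
      exact Finset.monotone_filter_right _ fun _ _ h => h.1
    refine le_trans ?_ (Finset.single_le_sum (fun _ _ => zero_le)
      (Finset.mem_univ (Finset.univ.filter fun j : ι => S j ∈ A)))
    refine le_trans ?_ (Finset.single_le_sum (fun _ _ => zero_le) hK)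
    rw [Set.indicator_of_mem (mem_patternSet_filter A B S)]
  refine (lintegral_mono hpt).trans ?_
  have hm := fun J K : Finset ι => measurableSet_patternSet hA hB J K
  rw [lintegral_finsetSum _ fun J _ => Finset.measurable_sum _ fun K _ =>
    measurable_const.indicator (hm J K)]
  calc ∑ J : Finset ι, ∫⁻ S, ∑ K ∈ J.powerset, (patternSet A B J K).indicator
          (fun _ => likelihoodRatio J.card K.card (D[B | A])) S ∂Measure.pi (fun _ : ι => D)
      = ∑ J : Finset ι, D A ^ J.card * D Aᶜ ^ (Fintype.card ι - J.card) *
          ∑ i ∈ Finset.range (J.card + 1), J.card.choose i • (D[B | A] ^ i *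
            (1 - D[B | A]) ^ (J.card - i) * likelihoodRatio J.card i (D[B | A])) := by
        refine Finset.sum_congr rfl fun J _ => ?_
        rw [lintegral_finsetSum _ fun K _ => measurable_const.indicator (hm J K),
          ← Finset.sum_powerset_apply_card (fun i => D[B | A] ^ i *
            (1 - D[B | A]) ^ (J.card - i) * likelihoodRatio J.card i (D[B | A])), Finset.mul_sum]
        refine Finset.sum_congr rfl fun K hK => ?_
        rw [lintegral_indicator_const (hm J K),
          measure_pi_patternSet D hA hB (Finset.mem_powerset.1 hK)]
        ring
    _ ≤ ∑ J : Finset ι, D A ^ J.card * D Aᶜ ^ (Fintype.card ι - J.card) *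
          ENNReal.ofReal (2 * √(Fintype.card ι)) := by
        gcongr with J
        exact sum_choose_mul_likelihoodRatio_le (Finset.card_le_univ J) hι _
    _ = ENNReal.ofReal (2 * √(Fintype.card ι)) := by
        rw [← Finset.sum_mul, Fintype.sum_pow_mul_eq_add_pow, measure_add_measure_compl hA]
        simp

end ExponentialMoment

/-- The Donsker–Varadhan inequality for bounded functions. -/
lemma integral_le_integral_llr_add_log {H : Type*} [MeasurableSpace H] {P Q : Measure H}
    [IsProbabilityMeasure P] [IsProbabilityMeasure Q] (hQP : Q ≪ P)
    (hint : Integrable (llr Q P) Q) {f : H → ℝ} (hf : Measurable f) {C : ℝ}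
    (hC : ∀ x, |f x| ≤ C) :
    ∫ x, f x ∂Q ≤ ∫ x, llr Q P x ∂Q + Real.log (∫ x, Real.exp (f x) ∂P) := by
  have hfQ : Integrable f Q := .of_bound hf.aestronglyMeasurable C (ae_of_all _ hC)
  have hfP : Integrable (fun x => Real.exp (f x)) P := by
    refine .of_bound hf.exp.aestronglyMeasurable (Real.exp C) (ae_of_all _ fun x => ?_)
    rw [Real.norm_eq_abs, Real.abs_exp]
    exact Real.exp_le_exp.2 ((le_abs_self _).trans (hC x))
  have := isProbabilityMeasure_tilted hfP
  have h := InformationTheory.integral_llr_add_sub_measure_univ_nonneg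
    (hQP.trans (absolutelyContinuous_tilted hfP)) (integrable_llr_tilted_right hQP hfQ hint hfP)
  rw [integral_llr_tilted_right hQP hfQ hfP hint] at h
  simp only [probReal_univ] at h
  linarith

lemma klBin_le_of_forall_le {q p c : ℝ} (hq0 : 0 ≤ q) (hq1 : q ≤ 1) (hp0 : 0 ≤ p) (hp1 : p ≤ 1)
    (h : ∀ u v : ℝ, 0 < u → 0 < v →
      q * Real.log u + (1 - q) * Real.log v + 1 - p * u - (1 - p) * v ≤ c) :
    klBin q p ≤ c := by
  have hc : 0 ≤ c := by
    have := h 1 1 one_pos one_pos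
    simp at this
    linarith
  have hq1' : 0 ≤ 1 - q := by linarith
  rcases hp0.eq_or_lt with rfl | hp0
  · refine le_trans ?_ hc
    simpa [klBin] using Real.mul_log_nonpos hq1' (by linarith)
  rcases hp1.eq_or_lt with rfl | hp1
  · refine le_trans ?_ hc
    simpa [klBin] using Real.mul_log_nonpos hq0 hq1
  have hp1' : 0 < 1 - p := by linarith
  have mul_log_le {a r ε : ℝ} (ha : 0 ≤ a) (hr : 0 < r) (hε : 0 < ε) :
      a * Real.log (a / r) ≤ a * Real.log (a / r + ε) := by
    rcases ha.eq_or_lt with rfl | ha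
    · simp
    · gcongr
      linarith
  refine le_of_forall_pos_le_add fun ε hε => ?_
  have h1 := h (q / p + ε) ((1 - q) / (1 - p) + ε) (by positivity) (by positivity)
  have h2 := mul_log_le hq0 hp0 hε
  have h3 := mul_log_le hq1' hp1' hε
  have h4 : p * (q / p + ε) = q + p * ε := by field_simp
  have h5 : (1 - p) * ((1 - q) / (1 - p) + ε) = 1 - q + (1 - p) * ε := by field_simp
  rw [klBin]
  linarith

/-- Change of measure: an exponential moment bound under the prior `P` controls the binary
divergence of the means under any posterior `Q`. -/
lemma klBin_integral_le {H : Type*} [MeasurableSpace H] {P Q : Measure H}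
    [IsProbabilityMeasure P] [IsProbabilityMeasure Q] (hQP : Q ≪ P)
    (hint : Integrable (llr Q P) Q) {k : ℕ} (hk : k ≠ 0) {N : H → ℕ} (hN : Measurable N)
    (hNk : ∀ x, N x ≤ k) {p : H → ℝ} (hp : Measurable p) (hp0 : ∀ x, 0 ≤ p x)
    (hp1 : ∀ x, p x ≤ 1) {M : ℝ} (hM : 0 < M)
    (hF : ∫⁻ x, likelihoodRatio k (N x) (ENNReal.ofReal (p x)) ∂P ≤ ENNReal.ofReal M) :
    klBin (∫ x, (N x / k : ℝ) ∂Q) (∫ x, p x ∂Q) ≤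
      (k : ℝ)⁻¹ * (∫ x, llr Q P x ∂Q + Real.log M) := by
  have hk0 : (0 : ℝ) < k := by positivity
  have hq0 : ∀ x, (0 : ℝ) ≤ N x / k := fun x => by positivity
  have hq1 : ∀ x, (N x / k : ℝ) ≤ 1 := fun x =>
    (div_le_one hk0).2 (by exact_mod_cast hNk x)
  have hq : Measurable fun x => (N x / k : ℝ) :=
    ((measurable_of_countable (fun n : ℕ => (n : ℝ))).comp hN).div_const _
  have hqi : Integrable (fun x => (N x / k : ℝ)) Q :=
    .of_bound hq.aestronglyMeasurable 1 (ae_of_all _ fun x => by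
      rw [Real.norm_eq_abs, abs_of_nonneg (hq0 x)]; exact hq1 x)
  have hpi : Integrable p Q :=
    .of_bound hp.aestronglyMeasurable 1 (ae_of_all _ fun x => by
      rw [Real.norm_eq_abs, abs_of_nonneg (hp0 x)]; exact hp1 x)
  have integral_le_one {g : H → ℝ} (hg : Integrable g Q) (hg1 : ∀ x, g x ≤ 1) :
      ∫ x, g x ∂Q ≤ 1 := by
    simpa using integral_mono hg (integrable_const 1) hg1
  refine klBin_le_of_forall_le (integral_nonneg hq0) (integral_le_one hqi hq1)
    (integral_nonneg hp0) (integral_le_one hpi hp1) fun u v hu hv => ?_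
  set f : H → ℝ := fun x => k * ((N x / k) * Real.log u + (1 - N x / k) * Real.log v +
      1 - p x * u - (1 - p x) * v) with hf_def
  have hf : Measurable f := by fun_prop
  have hfC : ∀ x, |f x| ≤ k * (|Real.log u| + |Real.log v| + 1 + u + v) := by
    intro x
    have hN1 : |(1 - N x / k : ℝ)| ≤ 1 := by
      rw [abs_le]; constructor <;> linarith [hq0 x, hq1 x]
    have hP1 : |1 - p x| ≤ 1 := by
      rw [abs_le]; constructor <;> linarith [hp0 x, hp1 x]
    have hN2 : |(N x / k : ℝ)| ≤ 1 := by rw [abs_of_nonneg (hq0 x)]; exact hq1 x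
    have hP2 : |p x| ≤ 1 := by rw [abs_of_nonneg (hp0 x)]; exact hp1 x
    have abs_mul_le {a : ℝ} (b : ℝ) (ha : |a| ≤ 1) : |a * b| ≤ |b| := by
      rw [abs_mul]; exact mul_le_of_le_one_left (abs_nonneg _) ha
    have i1 := abs_le.1 (abs_mul_le (Real.log u) hN2)
    have i2 := abs_le.1 (abs_mul_le (Real.log v) hN1)
    have i3 := abs_le.1 (abs_mul_le u hP2)
    have i4 := abs_le.1 (abs_mul_le v hP1)
    rw [abs_of_pos hu] at i3
    rw [abs_of_pos hv] at i4
    rw [hf_def, abs_mul, abs_of_pos hk0]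
    refine mul_le_mul_of_nonneg_left ?_ hk0.le
    rw [abs_le]
    constructor <;> linarith
  have hexp : ∫ x, Real.exp (f x) ∂P ≤ M := by
    rw [integral_eq_lintegral_of_nonneg_ae (ae_of_all _ fun x => (Real.exp_pos _).le)
      hf.exp.aestronglyMeasurable]
    refine ENNReal.toReal_le_of_le_ofReal hM.le (le_trans (lintegral_mono fun x => ?_) hF)
    exact ofReal_exp_le_likelihoodRatio hk (hNk x) (hp0 x) (hp1 x) hu hv
  have hexp_pos : 0 < ∫ x, Real.exp (f x) ∂P := by
    refine integral_exp_pos (.of_bound hf.exp.aestronglyMeasurable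
      (Real.exp (k * (|Real.log u| + |Real.log v| + 1 + u + v))) (ae_of_all _ fun x => ?_))
    rw [Real.norm_eq_abs, Real.abs_exp]
    exact Real.exp_le_exp.2 ((le_abs_self _).trans (hfC x))
  have hDV := integral_le_integral_llr_add_log hQP hint hf hfC
  have hlog := Real.log_le_log hexp_pos hexp
  have hf_int : ∫ x, f x ∂Q = k * ((∫ x, (N x / k : ℝ) ∂Q) * Real.log u +
      (1 - ∫ x, (N x / k : ℝ) ∂Q) * Real.log v + 1 - (∫ x, p x ∂Q) * u -
      (1 - ∫ x, p x ∂Q) * v) := by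
    rw [hf_def, integral_const_mul, integral_sub (by fun_prop) (by fun_prop),
      integral_sub (by fun_prop) (by fun_prop), integral_add (by fun_prop) (by fun_prop),
      integral_add (by fun_prop) (by fun_prop)]
    simp only [integral_mul_const]
    rw [integral_sub (by fun_prop) hqi, integral_sub (by fun_prop) hpi]
    simp
  rw [hf_int] at hDV
  rw [inv_mul_eq_div, le_div_iff₀ hk0]
  linarith

theorem conditional_pac_bayes_correct
    {X Y H : Type*} [MeasurableSpace X] [MeasurableSpace Y] [MeasurableSpace H]
    (D : Measure (X × Y)) [IsProbabilityMeasure D]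
    (P : Measure H) [IsProbabilityMeasure P]
    (ℓ : H → X × Y → ℝ)
    (hbin : ∀ h' z, ℓ h' z = 0 ∨ ℓ h' z = 1)
    (hmeas : Measurable fun p : H × (X × Y) => ℓ p.1 p.2)
    (h : H) (m : ℕ) (hm : 0 < m)
    (δ : ℝ) (hδ : 0 < δ) (hδ1 : δ ≤ 1) :
    1 - ENNReal.ofReal δ ≤
      Measure.pi (fun _ : Fin m => D)
        {S : Fin m → X × Y | ∀ Q : Measure H, IsProbabilityMeasure Q →
          ENNReal.ofReal
              (klBin
                -- b̂_S^Q(h): Q-average empirical loss on S_{(h,0)} = {j | ℓ(h(x_j),y_j) = 0}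
                (∫ h', (((Finset.univ.filter fun j : Fin m => ℓ h (S j) = 0).card : ℝ))⁻¹ *
                    ∑ j ∈ Finset.univ.filter fun j : Fin m => ℓ h (S j) = 0, ℓ h' (S j) ∂Q)
                -- b_D^Q(h): Q-stochastic risk conditioned on h being correct
                (∫ z, (∫ h', ℓ h' z ∂Q) ∂(D[|{z | ℓ h z = 0}])))
            ≤ (((Finset.univ.filter fun j : Fin m => ℓ h (S j) = 0).card : ℝ≥0∞))⁻¹ *
                (klDivM Q P + ENNReal.ofReal (Real.log (2 * Real.sqrt m / δ)))} := by
  have hℓ (h' : H) : Measurable (ℓ h') := hmeas.comp measurable_prodMk_left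
  set A : Set (X × Y) := {z | ℓ h z = 0} with hA_def
  have hA : MeasurableSet A := hℓ h (measurableSet_singleton 0)
  let B (h' : H) : Set (X × Y) := {z | ℓ h' z = 1}
  have hB (h' : H) : MeasurableSet (B h') := hℓ h' (measurableSet_singleton 1)
  let k (S : Fin m → X × Y) : ℕ := (Finset.univ.filter fun j => S j ∈ A).card
  let N (S : Fin m → X × Y) (h' : H) : ℕ :=
    (Finset.univ.filter fun j => S j ∈ A ∧ S j ∈ B h').card
  let p (h' : H) : ℝ≥0∞ := D[B h' | A]
  have hk : Measurable k := measurable_card_filter fun j => measurable_pi_apply j hA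
  have hN : Measurable fun x : (Fin m → X × Y) × H => N x.1 x.2 := by
    refine measurable_card_filter (p := fun (x : (Fin m → X × Y) × H) j =>
      x.1 j ∈ A ∧ x.1 j ∈ B x.2) fun j => ?_
    have hj : Measurable fun x : (Fin m → X × Y) × H => x.1 j := by fun_prop
    exact (hj hA).inter (hmeas.comp (measurable_snd.prodMk hj) (measurableSet_singleton 1))
  have hp : Measurable p := measurable_measure_prodMk_left (hmeas (measurableSet_singleton 1))
  have hW : Measurable fun x : (Fin m → X × Y) × H =>
      likelihoodRatio (k x.1) (N x.1 x.2) (p x.2) :=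
    measurable_likelihoodRatio (hk.comp measurable_fst) hN (hp.comp measurable_snd)
  set μ := Measure.pi fun _ : Fin m => D
  let F (S : Fin m → X × Y) : ℝ≥0∞ := ∫⁻ h', likelihoodRatio (k S) (N S h') (p h') ∂P
  have hF : Measurable F := hW.lintegral_prod_right'
  have hm1 : (1 : ℝ) ≤ √m := Real.one_le_sqrt.2 (by exact_mod_cast hm)
  have hM : 1 < 2 * √m / δ := by
    rw [lt_div_iff₀ hδ]
    linarith
  have hFint : ∫⁻ S, F S ∂μ ≤ ENNReal.ofReal (2 * √m) := by
    rw [lintegral_lintegral_swap hW.aemeasurable]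
    calc _ ≤ ∫⁻ _, ENNReal.ofReal (2 * √m) ∂P := lintegral_mono fun h' => by
          simpa using lintegral_likelihoodRatio_le (ι := Fin m) D hA (hB h') (by simpa using hm)
      _ = _ := by simp
  have hbad : μ {S | F S ≤ ENNReal.ofReal (2 * √m / δ)}ᶜ ≤ ENNReal.ofReal δ := by
    have hM0 : ENNReal.ofReal (2 * √m / δ) ≠ 0 := by
      rw [ne_eq, ENNReal.ofReal_eq_zero]
      linarith
    calc μ {S | F S ≤ ENNReal.ofReal (2 * √m / δ)}ᶜ
        ≤ μ {S | ENNReal.ofReal (2 * √m / δ) ≤ F S} := by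
          refine measure_mono fun S hS => ?_
          exact le_of_not_ge (by simpa using hS)
      _ ≤ (∫⁻ S, F S ∂μ) / ENNReal.ofReal (2 * √m / δ) :=
          meas_ge_le_lintegral_div hF.aemeasurable hM0 ENNReal.ofReal_ne_top
      _ ≤ ENNReal.ofReal (2 * √m) / ENNReal.ofReal (2 * √m / δ) := by gcongr
      _ = ENNReal.ofReal δ := by
          rw [← ENNReal.ofReal_div_of_pos (by linarith)]
          congr 1
          field_simp
  calc 1 - ENNReal.ofReal δ
      ≤ 1 - μ {S | F S ≤ ENNReal.ofReal (2 * √m / δ)}ᶜ := tsub_le_tsub_left hbad 1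
    _ = μ {S | F S ≤ ENNReal.ofReal (2 * √m / δ)} := by
        have hgood : MeasurableSet {S | F S ≤ ENNReal.ofReal (2 * √m / δ)} := hF measurableSet_Iic
        rw [← prob_compl_eq_one_sub hgood.compl, compl_compl]
    _ ≤ _ := measure_mono ?_
  intro S hS Q hQ
  replace hS : F S ≤ ENNReal.ofReal (2 * √m / δ) := hS
  have hcard : (Finset.univ.filter fun j : Fin m => ℓ h (S j) = 0).card = k S := by
    simp only [k, hA_def, Set.mem_ofPred_eq]
  have hsum (h' : H) :
      ∑ j ∈ Finset.univ.filter fun j : Fin m => ℓ h (S j) = 0, ℓ h' (S j) = N S h' := by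
    have hind (j : Fin m) : ℓ h' (S j) = if S j ∈ B h' then 1 else 0 := by
      rcases hbin h' (S j) with h0 | h0 <;> simp [B, h0]
    simp_rw [hind, Finset.sum_boole, Finset.filter_filter]
    simp only [N, hA_def, Set.mem_ofPred_eq]
  have hrisk (h' : H) : ∫ z, ℓ h' z ∂D[|A] = (p h').toReal := by
    have hind : ℓ h' = (B h').indicator 1 := by
      funext z
      rcases hbin h' z with h0 | h0 <;> simp [B, h0]
    rw [hind, integral_indicator_one (hB h')]
    rfl
  have hswap : ∫ z, ∫ h', ℓ h' z ∂Q ∂D[|A] = ∫ h', (p h').toReal ∂Q := by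
    have hi : Integrable (Function.uncurry fun z h' => ℓ h' z) (D[|A].prod Q) := by
      refine .of_bound (hmeas.comp measurable_swap).aestronglyMeasurable 1 (ae_of_all _ ?_)
      rintro ⟨z, h'⟩
      rcases hbin h' z with h0 | h0 <;> simp [Function.uncurry, h0]
    rw [integral_integral_swap hi]
    exact integral_congr_ae (ae_of_all _ hrisk)
  rw [hswap, hcard]
  simp_rw [hsum]
  have hL : 0 < Real.log (2 * √m / δ) := Real.log_pos hM
  rcases eq_or_ne (k S) 0 with hk0 | hk0
  · rw [hk0, Nat.cast_zero (R := ℝ≥0∞), ENNReal.inv_zero, ENNReal.top_mul]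
    · exact le_top
    · simp [hL]
  rw [klDivM]
  split_ifs with hQP
  · have hp1 (h' : H) : p h' ≤ 1 := prob_le_one
    have hFS : ∫⁻ h', likelihoodRatio (k S) (N S h') (ENNReal.ofReal (p h').toReal) ∂P ≤
        ENNReal.ofReal (2 * √m / δ) := by
      simpa only [ENNReal.ofReal_toReal (ne_top_of_le_ne_top ENNReal.one_ne_top (hp1 _))] using hS
    have key := klBin_integral_le hQP.1 hQP.2 hk0 (hN.comp measurable_prodMk_left)
      (fun h' => Finset.card_le_card
        (Finset.monotone_filter_right _ fun _ _ hj => hj.1)) hp.ennreal_toReal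
      (fun h' => ENNReal.toReal_nonneg)
      (fun h' => ENNReal.toReal_le_of_le_ofReal zero_le_one (by simpa using hp1 h'))
      (zero_lt_one.trans hM) hFS
    simp_rw [div_eq_inv_mul] at key ⊢
    refine (ENNReal.ofReal_le_ofReal key).trans ?_
    rw [ENNReal.ofReal_mul (by positivity), ENNReal.ofReal_inv_of_pos (by positivity),
      ENNReal.ofReal_natCast]
    gcongr
    exact ENNReal.ofReal_add_le
  · rw [top_add, ENNReal.mul_top (by simp)]
    exact le_top
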